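/- Suppose q is a power of 2. Then the number a_n of n×n matrices A over 𝔽_q satisfying A² = I equals Σ_{0 ≤ i ≤ n/2} γ_n/(q^{i(2n−3i)} · γ_i · γ_{n−2i}). -/

import Mathlib

/-- `gam q n` is the order of `GL_n(F_q)`: `∏_{i=0}^{n-1} (q^n - q^i)`. -/
def gam (q n : ℕ) : ℕ := ∏ i ∈ Finset.range n, (q ^ n - q ^ i)

open Matrix Module

theorem Nat.card_eq_mul_of_card_fiber {α β : Type*} [Finite α] [Finite β] (f : α → β) (k : ℕ)
    (h : ∀ y, Nat.card {x // f x = y} = k) : Nat.card α = Nat.card β * k := by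
  have := Fintype.ofFinite β
  rw [Nat.card_congr (Equiv.sigmaFiberEquiv f).symm, Nat.card_sigma, Finset.sum_congr rfl
    fun y _ => h y]
  simp

section Rows

variable {F m n : Type*} [Field F] [Fintype m] [Fintype n]

theorem Matrix.linearIndependent_row_iff_rank_eq {B : Matrix m n F} :
    LinearIndependent F B.row ↔ B.rank = Fintype.card m := by
  rw [linearIndependent_iff_card_eq_finrank_span, B.rank_eq_finrank_span_row, Set.finrank, eq_comm]

theorem Matrix.exists_right_inverse_of_linearIndependent_row [DecidableEq m] {B : Matrix m n F}
    (hB : LinearIndependent F B.row) : ∃ B' : Matrix n m F, B * B' = 1 := by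
  rw [← mulVec_surjective_iff_exists_right_inverse]
  have h : LinearMap.range B.mulVecLin = ⊤ := by
    apply Submodule.eq_top_of_finrank_eq
    rw [finrank_fintype_fun_eq_card]
    exact linearIndependent_row_iff_rank_eq.1 hB
  exact LinearMap.range_eq_top.1 h

end Rows

section Counting

variable {F : Type} [Field F] [Fintype F] {n : ℕ}

/-- The number of linearly independent `i`-tuples that are annihilated by `i` given linearly
independent functionals. -/
theorem card_linearIndependent_row_mul_transpose_eq_zero {i : ℕ} (hi : 2 * i ≤ n)
    {B : Matrix (Fin i) (Fin n) F} (hB : LinearIndependent F B.row) :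
    Nat.card {C : Matrix (Fin i) (Fin n) F // LinearIndependent F C.row ∧ C * Bᵀ = 0} =
      ∏ j ∈ Finset.range i, (Fintype.card F ^ (n - i) - Fintype.card F ^ j) := by
  have hdim : finrank F (LinearMap.ker B.mulVecLin) = n - i := by
    have h1 := LinearMap.finrank_range_add_finrank_ker B.mulVecLin
    have h2 : finrank F (LinearMap.range B.mulVecLin) = Fintype.card (Fin i) :=
      linearIndependent_row_iff_rank_eq.1 hB
    rw [h2, finrank_fintype_fun_eq_card] at h1
    simp only [Fintype.card_fin] at h1
    omega
  rw [← Fin.prod_univ_eq_prod_range (fun j => Fintype.card F ^ (n - i) - Fintype.card F ^ j),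
    ← hdim, ← card_linearIndependent (by omega)]
  have key (C : Matrix (Fin i) (Fin n) F) :
      C * Bᵀ = 0 ↔ ∀ j, C.row j ∈ LinearMap.ker B.mulVecLin := by
    rw [← Matrix.transpose_inj]
    simp only [transpose_mul, transpose_transpose, transpose_zero, LinearMap.mem_ker,
      mulVecLin_apply, funext_iff, ← Matrix.ext_iff]
    exact ⟨fun h j k => h k j, fun h k j => h j k⟩
  refine Nat.card_congr
    { toFun := fun C => ⟨fun j => ⟨C.1.row j, (key _).1 C.2.2 j⟩, ?_⟩
      invFun := fun s => ⟨Matrix.of fun j => (s.1 j : Fin n → F), ?_, ?_⟩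
      left_inv := fun C => rfl
      right_inv := fun s => rfl }
  · exact LinearIndependent.of_comp (Submodule.subtype _) C.2.1
  · exact s.2.map' (Submodule.subtype _) (Submodule.ker_subtype _)
  · exact (key _).2 fun j => (s.1 j).2

/-- Rank factorizations of a square-zero matrix `N` correspond to bases of the range of `N`. -/
theorem card_rank_factorization {i : ℕ} {N : Matrix (Fin n) (Fin n) F} (hN : N * N = 0)
    (hr : N.rank = i) :
    Nat.card {p : Matrix (Fin i) (Fin n) F × Matrix (Fin i) (Fin n) F //
      (LinearIndependent F p.1.row ∧ LinearIndependent F p.2.row ∧ p.2 * p.1ᵀ = 0) ∧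
        p.1ᵀ * p.2 = N} = gam (Fintype.card F) i := by
  have hdim : finrank F (LinearMap.range N.mulVecLin) = i := hr
  have hcard := card_linearIndependent (K := F) (V := LinearMap.range N.mulVecLin) hdim.ge
  rw [hdim, Fin.prod_univ_eq_prod_range
    (fun j => Fintype.card F ^ i - Fintype.card F ^ j)] at hcard
  rw [gam, ← hcard]
  have hmem {B C : Matrix (Fin i) (Fin n) F} (hC : LinearIndependent F C.row)
      (h : Bᵀ * C = N) (j : Fin i) : B.row j ∈ LinearMap.range N.mulVecLin := by
    obtain ⟨C', hC'⟩ := exists_right_inverse_of_linearIndependent_row hC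
    have : N * C' = Bᵀ := by rw [← h, Matrix.mul_assoc, hC', Matrix.mul_one]
    refine ⟨C'.col j, ?_⟩
    ext k
    exact congrFun (congrFun this k) j
  refine Nat.card_congr (Equiv.ofBijective
    (fun p => ⟨fun j => ⟨p.1.1.row j, hmem p.2.1.2.1 p.2.2 j⟩,
      LinearIndependent.of_comp (Submodule.subtype _) p.2.1.1⟩) ⟨?_, ?_⟩)
  · rintro ⟨⟨B, C⟩, ⟨hB, hC, h0⟩, h⟩ ⟨⟨B₂, C₂⟩, ⟨hB₂, hC₂, h0₂⟩, h₂⟩ he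
    obtain rfl : B = B₂ := by
      ext j k
      exact congrFun (congrArg Subtype.val (congrFun (congrArg Subtype.val he) j)) k
    obtain ⟨B', hB'⟩ := exists_right_inverse_of_linearIndependent_row hB
    have hL : B'ᵀ * Bᵀ = 1 := by rw [← transpose_mul, hB', transpose_one]
    obtain rfl : C = C₂ := by
      simp only at h h₂
      rw [← Matrix.one_mul C, ← hL, Matrix.mul_assoc, h, ← h₂, ← Matrix.mul_assoc, hL,
        Matrix.one_mul]
    rfl
  · rintro ⟨s, hs⟩
    let B : Matrix (Fin i) (Fin n) F := Matrix.of fun j => (s j : Fin n → F)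
    have hB : LinearIndependent F B.row :=
      hs.map' (Submodule.subtype _) (Submodule.ker_subtype _)
    have hrange : LinearMap.range Bᵀ.mulVecLin = LinearMap.range N.mulVecLin := by
      apply Submodule.eq_of_le_of_finrank_eq
      · rw [range_mulVecLin, Submodule.span_le]
        rintro _ ⟨j, rfl⟩
        exact (s j).2
      · rw [hdim]
        change Bᵀ.rank = i
        rw [rank_transpose, linearIndependent_row_iff_rank_eq.1 hB, Fintype.card_fin]
    have hcol (k : Fin n) : ∃ c : Fin i → F, Bᵀ *ᵥ c = N.col k := by
      have : N.col k ∈ LinearMap.range Bᵀ.mulVecLin := by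
        rw [hrange, range_mulVecLin]
        exact Submodule.subset_span ⟨k, rfl⟩
      exact this
    choose c hc using hcol
    let C : Matrix (Fin i) (Fin n) F := Matrix.of fun j k => c k j
    have h : Bᵀ * C = N := by
      ext a k
      exact congrFun (hc k) a
    have hC : LinearIndependent F C.row := by
      rw [linearIndependent_row_iff_rank_eq]
      refine le_antisymm C.rank_le_card_height ?_
      calc Fintype.card (Fin i) = (Bᵀ * C).rank := by rw [h, hr, Fintype.card_fin]
        _ ≤ C.rank := rank_mul_le_right _ _
    refine ⟨⟨⟨B, C⟩, ⟨hB, hC, ?_⟩, h⟩, rfl⟩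
    obtain ⟨B', hB'⟩ := exists_right_inverse_of_linearIndependent_row hB
    obtain ⟨C', hC'⟩ := exists_right_inverse_of_linearIndependent_row hC
    have hL : B'ᵀ * Bᵀ = 1 := by rw [← transpose_mul, hB', transpose_one]
    calc C * Bᵀ = (B'ᵀ * Bᵀ) * (C * Bᵀ) * (C * C') := by
          rw [hL, hC', Matrix.one_mul, Matrix.mul_one]
      _ = B'ᵀ * ((Bᵀ * C) * (Bᵀ * C)) * C' := by simp only [Matrix.mul_assoc]
      _ = 0 := by rw [h, hN, Matrix.mul_zero, Matrix.zero_mul]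

/-- Both sides count the rank factorizations `N = Bᵀ * C` of square-zero matrices of rank `i`. -/
theorem card_sq_zero_rank_mul_gam {i : ℕ} (hi : 2 * i ≤ n) :
    Nat.card {N : Matrix (Fin n) (Fin n) F // N * N = 0 ∧ N.rank = i} * gam (Fintype.card F) i =
      (∏ j ∈ Finset.range i, (Fintype.card F ^ n - Fintype.card F ^ j)) *
        ∏ j ∈ Finset.range i, (Fintype.card F ^ (n - i) - Fintype.card F ^ j) := by
  let S := {p : Matrix (Fin i) (Fin n) F × Matrix (Fin i) (Fin n) F //
    LinearIndependent F p.1.row ∧ LinearIndependent F p.2.row ∧ p.2 * p.1ᵀ = 0}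
  have hprod (p : S) : (p.1.1ᵀ * p.1.2) * (p.1.1ᵀ * p.1.2) = 0 ∧ (p.1.1ᵀ * p.1.2).rank = i := by
    obtain ⟨⟨B, C⟩, hB, hC, h0⟩ := p
    simp only at hB hC h0 ⊢
    refine ⟨?_, ?_⟩
    · rw [Matrix.mul_assoc, ← Matrix.mul_assoc C, h0, Matrix.zero_mul, Matrix.mul_zero]
    · obtain ⟨C', hC'⟩ := exists_right_inverse_of_linearIndependent_row hC
      have hBr : Bᵀ.rank = i := by
        rw [rank_transpose, linearIndependent_row_iff_rank_eq.1 hB, Fintype.card_fin]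
      refine le_antisymm ((rank_mul_le_left _ _).trans hBr.le) ?_
      have h : Bᵀ * C * C' = Bᵀ := by rw [Matrix.mul_assoc, hC', Matrix.mul_one]
      calc i = (Bᵀ * C * C').rank := by rw [h, hBr]
        _ ≤ _ := rank_mul_le_left _ _
  have h1 := Nat.card_eq_mul_of_card_fiber
    (fun p : S => (⟨p.1.1ᵀ * p.1.2, hprod p⟩ :
      {N : Matrix (Fin n) (Fin n) F // N * N = 0 ∧ N.rank = i}))
    (gam (Fintype.card F) i) (by
      rintro ⟨N, hN, hr⟩
      rw [← card_rank_factorization hN hr]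
      simp only [Subtype.mk.injEq]
      exact Nat.card_congr (Equiv.subtypeSubtypeEquivSubtypeInter _
        (fun p : Matrix (Fin i) (Fin n) F × Matrix (Fin i) (Fin n) F => p.1ᵀ * p.2 = N)))
  have h2 := Nat.card_eq_mul_of_card_fiber
    (fun p : S => (⟨p.1.1, p.2.1⟩ : {s : Fin i → Fin n → F // LinearIndependent F s}))
    (∏ j ∈ Finset.range i, (Fintype.card F ^ (n - i) - Fintype.card F ^ j)) (by
      rintro ⟨B, hB⟩
      rw [← card_linearIndependent_row_mul_transpose_eq_zero hi (B := B) hB]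
      exact Nat.card_congr
        { toFun := fun p => ⟨p.1.1.2, p.1.2.2.1, by
            have h : p.1.1.1 = B := congrArg Subtype.val p.2
            have h0 := p.1.2.2.2
            rw [h] at h0
            exact h0⟩
          invFun := fun C => ⟨⟨(B, C.1), hB, C.2.1, C.2.2⟩, rfl⟩
          left_inv := by
            rintro ⟨⟨⟨B₂, C⟩, h⟩, he⟩
            obtain rfl : B₂ = B := congrArg Subtype.val he
            rfl
          right_inv := fun C => rfl })
  rw [← h1, h2, card_linearIndependent (by rw [finrank_fin_fun]; omega), finrank_fin_fun,
    Fin.prod_univ_eq_prod_range (fun j => Fintype.card F ^ n - Fintype.card F ^ j)]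

theorem card_sq_zero_eq_sum_rank :
    Nat.card {N : Matrix (Fin n) (Fin n) F // N * N = 0} =
      ∑ i ∈ Finset.range (n / 2 + 1),
        Nat.card {N : Matrix (Fin n) (Fin n) F // N * N = 0 ∧ N.rank = i} := by
  classical
  simp only [Nat.card_eq_fintype_card, Fintype.card_subtype]
  rw [Finset.card_eq_sum_card_fiberwise (f := fun N => N.rank) (t := Finset.range (n / 2 + 1))]
  · simp only [Finset.filter_filter]
  · intro N hN
    have hN : N * N = 0 := by simpa using hN
    have := rank_add_rank_le_card_of_mul_eq_zero hN
    rw [Fintype.card_fin] at this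
    simp only [Finset.coe_range, Set.mem_Iio]
    omega

end Counting

/-- In characteristic two, translation by the identity matches matrices with `A ^ 2 = 1` with
square-zero matrices. -/
theorem card_sq_eq_one_eq_card_sq_zero {F : Type} [Field F] [CharP F 2] {n : ℕ} :
    Nat.card {A : Matrix (Fin n) (Fin n) F // A ^ 2 = 1} =
      Nat.card {N : Matrix (Fin n) (Fin n) F // N * N = 0} := by
  have hdouble (A : Matrix (Fin n) (Fin n) F) : A + A = 0 := by
    ext j k
    exact CharTwo.add_self_eq_zero _
  refine Nat.card_congr ((Equiv.addRight (1 : Matrix (Fin n) (Fin n) F)).subtypeEquiv fun A => ?_)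
  have h : (A + 1) * (A + 1) = A ^ 2 + 1 := by
    calc (A + 1) * (A + 1) = A ^ 2 + 1 + (A + A) := by noncomm_ring
      _ = _ := by rw [hdouble, add_zero]
  have h1 : -(1 : Matrix (Fin n) (Fin n) F) = 1 := neg_eq_of_add_eq_zero_left (hdouble 1)
  rw [Equiv.coe_addRight, h, add_eq_zero_iff_eq_neg, h1]

theorem gam_eq_prod_mul_gam_sub {q n k : ℕ} (hk : k ≤ n) :
    gam q n = (∏ j ∈ Finset.range k, (q ^ n - q ^ j)) * q ^ (k * (n - k)) * gam q (n - k) := by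
  obtain ⟨m, rfl⟩ := Nat.exists_eq_add_of_le hk
  have h (j : ℕ) : q ^ (k + m) - q ^ (k + j) = q ^ k * (q ^ m - q ^ j) := by
    rw [pow_add, pow_add, Nat.mul_sub]
  simp only [gam, Finset.prod_range_add, h, Finset.prod_mul_distrib, Finset.prod_const,
    Finset.card_range, Nat.add_sub_cancel_left, pow_mul, mul_assoc]

theorem gam_pos {q : ℕ} (hq : 1 < q) (n : ℕ) : 0 < gam q n :=
  Finset.prod_pos fun _ hi => Nat.sub_pos_of_lt (Nat.pow_lt_pow_right hq (Finset.mem_range.1 hi))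

theorem involutionCount_eq_sum_of_char_two {F : Type} [Field F] [Fintype F] (q : ℕ)
    (hq : Fintype.card F = q) (h2 : ∃ m : ℕ, q = 2 ^ m) (n : ℕ) :
    (Nat.card {A : Matrix (Fin n) (Fin n) F // A ^ 2 = 1} : ℚ)
      = ∑ i ∈ Finset.range (n / 2 + 1),
          (gam q n : ℚ) / ((q : ℚ) ^ (i * (2 * n - 3 * i)) * (gam q i : ℚ) * (gam q (n - 2 * i) : ℚ)) := by
  have hF : CharP F 2 := by
    obtain ⟨m, hm⟩ := h2
    have h : ((Fintype.card F : ℕ) : F) = 0 := Nat.cast_card_eq_zero F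
    rw [hq, hm, Nat.cast_pow] at h
    exact CharTwo.of_one_ne_zero_of_two_eq_zero one_ne_zero
      (by exact_mod_cast eq_zero_of_pow_eq_zero h)
  have hq1 : 1 < q := hq ▸ Fintype.one_lt_card
  rw [card_sq_eq_one_eq_card_sq_zero, card_sq_zero_eq_sum_rank, Nat.cast_sum]
  refine Finset.sum_congr rfl fun i hi => ?_
  have hi : 2 * i ≤ n := by have := Finset.mem_range.1 hi; omega
  have hcount := card_sq_zero_rank_mul_gam (F := F) hi
  rw [hq] at hcount
  have hqpos : (0 : ℚ) < q := by exact_mod_cast hq1.le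
  have hpos (k : ℕ) : (0 : ℚ) < gam q k := by exact_mod_cast gam_pos hq1 k
  have hexp : i * (2 * n - 3 * i) = i * (n - i) + i * (n - i - i) := by
    rw [← mul_add]
    congr 1
    omega
  rw [eq_div_iff (by have := hpos i; have := hpos (n - 2 * i); positivity)]
  have hsub : n - 2 * i = n - i - i := by omega
  rw [hexp, hsub]
  norm_cast
  rw [gam_eq_prod_mul_gam_sub (q := q) (n := n) (k := i) (by omega),
    gam_eq_prod_mul_gam_sub (q := q) (n := n - i) (k := i) (by omega), pow_add]
  linear_combination q ^ (i * (n - i)) * q ^ (i * (n - i - i)) * gam q (n - i - i) * hcount
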